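/- Let λ > 0 and let ψ : ℝ → (0,∞) be Borel with ∫_x^∞ ψ(z)e^{−λz}dz < ∞ for every x ∈ ℝ. Set Φ(y) := 1 − e^{λy}∫_y^∞ ψ(z)e^{−λz}dz, φ(y) := ψ(y) − λe^{λy}∫_y^∞ ψ(z)e^{−λz}dz, and M_t^{λ,φ} := { ψ(S_t)·sinh(λ(S_t − X_t))/λ + e^{λX_t}·∫_{S_t}^∞ ψ(z)e^{−λz}dz } · e^{−λ²t/2}. Then for every x ∈ ℝ, every u ≥ 0, and every Γ ∈ F_u, lim_{t→∞} E_x[ 1_Γ · ψ(S_t)·e^{λ(S_t − X_t)} ] / E_x[ ψ(S_t)·e^{λ(S_t − X_t)} ] = E_x[ 1_Γ · M_u^{λ,φ} ] / (1 − Φ(x)). -/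

import Mathlib

open MeasureTheory ProbabilityTheory Filter
open scoped NNReal ENNReal Topology

noncomputable section

/-- The natural filtration `F_t = σ(X_s : s ≤ t)` of a real-valued process indexed by `ℝ≥0`. -/
def natFiltration {Ω : Type*} [m : MeasurableSpace Ω] (X : ℝ≥0 → Ω → ℝ) :
    MeasureTheory.Filtration ℝ≥0 m where
  seq t := (⨆ s ∈ Set.Iic t, MeasurableSpace.comap (X s) Real.measurableSpace) ⊓ m
  mono' := fun s t hst =>
    inf_le_inf_right m (biSup_mono fun u (hu : u ∈ Set.Iic s) => le_trans hu hst)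
  le' := fun _ => inf_le_right

/-- The running supremum `S_t = sup_{0 ≤ u ≤ t} X_u` of a process indexed by `ℝ≥0`. -/
def runSup {Ω : Type*} (X : ℝ≥0 → Ω → ℝ) (t : ℝ≥0) (ω : Ω) : ℝ :=
  sSup ((fun u => X u ω) '' Set.Iic t)

/-- A real-valued process `X` indexed by `ℝ≥0` is a standard one-dimensional Brownian
motion started at `x` under `P`. -/
structure IsBrownianMotion {Ω : Type*} [m : MeasurableSpace Ω] (P : Measure Ω)
    (X : ℝ≥0 → Ω → ℝ) (x : ℝ) : Prop where
  stronglyMeasurable : ∀ t, StronglyMeasurable (X t)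
  init : ∀ᵐ ω ∂P, X 0 ω = x
  cont : ∀ᵐ ω ∂P, Continuous fun t => X t ω
  gauss_incr : ∀ s t : ℝ≥0, s ≤ t →
    P.map (fun ω => X t ω - X s ω) = gaussianReal 0 (t - s)
  indep_incr : ∀ s t : ℝ≥0, s ≤ t →
    Indep (MeasurableSpace.comap (fun ω => X t ω - X s ω) Real.measurableSpace)
      (natFiltration X s) P

lemma hasDerivAt_cdf_gaussianReal (μ : ℝ) {v : ℝ≥0} (hv : v ≠ 0) (s : ℝ) :
    HasDerivAt (cdf (gaussianReal μ v)) (gaussianPDFReal μ v s) s := by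
  have hcont : Continuous (gaussianPDFReal μ v) := by
    unfold gaussianPDFReal; fun_prop
  have hcdf : ∀ r, cdf (gaussianReal μ v) r = ∫ y in Set.Iic r, gaussianPDFReal μ v y := by
    intro r
    rw [cdf_eq_real, measureReal_def, gaussianReal_apply_eq_integral _ hv,
      ENNReal.toReal_ofReal (integral_nonneg fun y => gaussianPDFReal_nonneg _ _ _)]
  have hint := integrable_gaussianPDFReal μ v
  have : (cdf (gaussianReal μ v) : ℝ → ℝ) = fun r =>
      (∫ y in (0 : ℝ)..r, gaussianPDFReal μ v y) + cdf (gaussianReal μ v) 0 := by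
    funext r
    rw [hcdf, hcdf, ← intervalIntegral.integral_Iic_sub_Iic hint.integrableOn hint.integrableOn]
    ring
  rw [this]
  exact (intervalIntegral.integral_hasDerivAt_right (hint.intervalIntegrable)
    (hcont.stronglyMeasurableAtFilter _ _) hcont.continuousAt).add_const _

/-- Up to the factor `exp (l ^ 2 * T / 2 - 2 * l * s)`, the density at `s` of the running maximum
at time `T` of a Brownian motion started at `0`, weighted by `exp (-(l * X_T))`. -/
def supDensity (l : ℝ) (T : ℝ≥0) (s : ℝ) : ℝ :=
  2 * l * (1 - cdf (gaussianReal (l * T) T) s) + 2 * gaussianPDFReal (l * T) T s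

lemma supDensity_nonneg {l : ℝ} (hl : 0 ≤ l) (T : ℝ≥0) (s : ℝ) : 0 ≤ supDensity l T s := by
  have h1 := cdf_le_one (gaussianReal (l * T) T) s
  have h2 := gaussianPDFReal_nonneg (l * T) T s
  unfold supDensity
  have := mul_nonneg hl (sub_nonneg.2 h1)
  linarith

lemma measurable_supDensity (l : ℝ) (T : ℝ≥0) : Measurable (supDensity l T) := by
  have h1 : Measurable (cdf (gaussianReal (l * T) T)) := (monotone_cdf _).measurable
  have h2 := measurable_gaussianPDFReal (l * T) T
  unfold supDensity
  fun_prop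

lemma gaussianPDFReal_le (μ : ℝ) {v : ℝ≥0} (hv : v ≠ 0) (s : ℝ) :
    gaussianPDFReal μ v s ≤ (√(v : ℝ))⁻¹ := by
  have hv' : (0 : ℝ) < v := by positivity
  unfold gaussianPDFReal
  calc (√(2 * Real.pi * v))⁻¹ * Real.exp (-(s - μ) ^ 2 / (2 * v))
      ≤ (√(v : ℝ))⁻¹ * 1 := by
        gcongr
        · nlinarith [Real.pi_gt_three]
        · rw [Real.exp_le_one_iff]
          exact div_nonpos_of_nonpos_of_nonneg (by nlinarith [sq_nonneg (s - μ)]) (by positivity)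
    _ = _ := mul_one _

lemma supDensity_le {l : ℝ} (hl : 0 ≤ l) {T : ℝ≥0} (hT : 1 ≤ T) (s : ℝ) :
    supDensity l T s ≤ 2 * l + 2 := by
  have h1 := cdf_nonneg (gaussianReal (l * T) T) s
  have h2 := gaussianPDFReal_le (l * T) (v := T) (by positivity) s
  have h3 : (√(T : ℝ))⁻¹ ≤ 1 := inv_le_one_of_one_le₀ (Real.one_le_sqrt.2 (by exact_mod_cast hT))
  unfold supDensity
  have := mul_nonneg hl h1
  nlinarith

lemma cdf_gaussianReal_le {l : ℝ} (hl : 0 ≤ l) (T : ℝ≥0) (s : ℝ) :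
    cdf (gaussianReal (l * T) T) s ≤ Real.exp (l * s - l ^ 2 * T / 2) := by
  have hm : mgf id (gaussianReal (l * T) T) (-l) = Real.exp (-(l ^ 2 * T / 2)) := by
    rw [mgf_gaussianReal (μ := l * T) (v := T) (by simp)]
    congr 1; ring
  have := measure_le_le_exp_mul_mgf (μ := gaussianReal (l * T) T) (X := id) s
    (neg_nonpos.2 hl) (by
      rw [← mgf_pos_iff, hm]; exact Real.exp_pos _)
  rw [hm, ← Real.exp_add] at this
  rw [cdf_eq_real]
  refine this.trans (Real.exp_le_exp.2 (by linarith))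

lemma tendsto_supDensity {l : ℝ} (hl : 0 < l) (s : ℝ) :
    Tendsto (fun T : ℝ≥0 => supDensity l T s) atTop (𝓝 (2 * l)) := by
  have hT : Tendsto (fun T : ℝ≥0 => (T : ℝ)) atTop atTop := NNReal.tendsto_coe_atTop.2 tendsto_id
  have h1 : Tendsto (fun T : ℝ≥0 => cdf (gaussianReal (l * T) T) s) atTop (𝓝 0) := by
    refine squeeze_zero (fun T => cdf_nonneg _ _) (fun T => cdf_gaussianReal_le hl.le T s) ?_
    refine Real.tendsto_exp_atBot.comp (tendsto_atBot_add_const_left _ _ ?_)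
    have : Tendsto (fun T : ℝ≥0 => l ^ 2 / 2 * (T : ℝ)) atTop atTop :=
      hT.const_mul_atTop (by positivity)
    refine (tendsto_neg_atTop_atBot.comp this).congr fun T => ?_
    simp only [Function.comp]; ring
  have h2 : Tendsto (fun T : ℝ≥0 => gaussianPDFReal (l * T) T s) atTop (𝓝 0) := by
    refine squeeze_zero' (.of_forall fun T => gaussianPDFReal_nonneg _ _ _)
      (g := fun T : ℝ≥0 => (√(T : ℝ))⁻¹) ?_ ?_
    · filter_upwards [eventually_gt_atTop 0] with T hT
      exact gaussianPDFReal_le _ hT.ne' s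
    · exact tendsto_inv_atTop_zero.comp (Real.tendsto_sqrt_atTop.comp hT)
  have := ((h1.const_sub 1).const_mul (2 * l)).add (h2.const_mul 2)
  simpa [supDensity] using this

lemma exp_mul_gaussianPDFReal (l : ℝ) {T : ℝ≥0} (hT : T ≠ 0) (y : ℝ) :
    Real.exp (l * y) * gaussianPDFReal 0 T y
      = Real.exp (l ^ 2 * T / 2) * gaussianPDFReal (l * T) T y := by
  have : (T : ℝ) ≠ 0 := by exact_mod_cast hT
  unfold gaussianPDFReal
  rw [mul_left_comm, mul_left_comm (Real.exp (l ^ 2 * T / 2)), ← Real.exp_add, ← Real.exp_add]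
  congr 2
  field_simp
  ring

lemma lintegral_exp_mul_gaussianReal_Ioi (l : ℝ) {T : ℝ≥0} (hT : T ≠ 0) (a : ℝ) :
    ∫⁻ y in Set.Ioi a, ENNReal.ofReal (Real.exp (l * y)) ∂gaussianReal 0 T
      = ENNReal.ofReal (Real.exp (l ^ 2 * T / 2) * (1 - cdf (gaussianReal (l * T) T) a)) := by
  have h1 : gaussianReal (l * T) T (Set.Ioi a)
      = ENNReal.ofReal (1 - cdf (gaussianReal (l * T) T) a) := by
    rw [cdf_eq_real, ← probReal_compl_eq_one_sub measurableSet_Iic, Set.compl_Iic,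
      ofReal_measureReal]
  rw [ENNReal.ofReal_mul (Real.exp_pos _).le, ← h1, gaussianReal_apply _ hT,
    gaussianReal_of_var_ne_zero _ hT,
    setLIntegral_withDensity_eq_setLIntegral_mul _ (measurable_gaussianPDF _ _) (by fun_prop)
      measurableSet_Ioi, ← lintegral_const_mul _ (measurable_gaussianPDF _ _)]
  refine lintegral_congr fun y => ?_
  rw [Pi.mul_apply, gaussianPDF, gaussianPDF, ← ENNReal.ofReal_mul (gaussianPDFReal_nonneg _ _ _),
    ← ENNReal.ofReal_mul (Real.exp_pos _).le, mul_comm, exp_mul_gaussianPDFReal l hT]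

/-- Tail of the density of the running maximum in terms of the Gaussian law of the endpoint. -/
lemma lintegral_reflection_eq_supDensity {l : ℝ} (hl : 0 < l) {T : ℝ≥0} (hT : T ≠ 0) (a : ℝ) :
    ∫⁻ y in Set.Ioi a, (ENNReal.ofReal (Real.exp (-l * y))
        + ENNReal.ofReal (Real.exp (-l * (2 * a - y)))) ∂gaussianReal 0 T
      = ∫⁻ s in Set.Ioi a, ENNReal.ofReal (Real.exp (l ^ 2 * T / 2)
          * (Real.exp (-(2 * l * s)) * supDensity l T s)) := by
  set G : ℝ → ℝ := fun s => (1 - cdf (gaussianReal (-l * T) T) s)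
    + Real.exp (-(2 * l * s)) * (1 - cdf (gaussianReal (l * T) T) s) with hG
  have hpdf : ∀ s, gaussianPDFReal (-l * T) T s
      = Real.exp (-(2 * l * s)) * gaussianPDFReal (l * T) T s := by
    intro s
    have h1 := exp_mul_gaussianPDFReal l hT s
    have h2 := exp_mul_gaussianPDFReal (-l) hT s
    rw [neg_sq] at h2
    refine mul_left_cancel₀ (Real.exp_pos (l ^ 2 * T / 2)).ne' ?_
    rw [← h2, mul_left_comm, ← h1, ← mul_assoc, ← Real.exp_add]
    congr 2; ring
  have hderiv : ∀ s, HasDerivAt G (-(Real.exp (-(2 * l * s)) * supDensity l T s)) s := by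
    intro s
    have hexp : HasDerivAt (fun s => Real.exp (-(2 * l * s)))
        (Real.exp (-(2 * l * s)) * -(2 * l)) s := by
      have := ((hasDerivAt_id s).const_mul (2 * l)).neg.exp
      simpa using this
    have := ((hasDerivAt_cdf_gaussianReal (-l * T) hT s).const_sub 1).add
      (hexp.mul ((hasDerivAt_cdf_gaussianReal (l * T) hT s).const_sub 1))
    refine this.congr_deriv ?_
    rw [hpdf, supDensity]; ring
  have hlim : Tendsto G atTop (𝓝 0) := by
    have h0 : Tendsto (fun s : ℝ => Real.exp (-(2 * l * s))) atTop (𝓝 0) :=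
      Real.tendsto_exp_neg_atTop_nhds_zero.comp (tendsto_id.const_mul_atTop (by positivity))
    have := ((tendsto_cdf_atTop (gaussianReal (-l * T) T)).const_sub 1).add
      (h0.mul ((tendsto_cdf_atTop (gaussianReal (l * T) T)).const_sub 1))
    simpa [hG] using this
  have hneg : ∀ s ∈ Set.Ioi a, -(Real.exp (-(2 * l * s)) * supDensity l T s) ≤ 0 := fun s _ =>
    neg_nonpos.2 (mul_nonneg (Real.exp_pos _).le (supDensity_nonneg hl.le T s))
  have hval := integral_Ioi_of_hasDerivAt_of_nonpos' (fun s _ => hderiv s) hneg hlim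
  have hint := (integrableOn_Ioi_deriv_of_nonpos' (fun s _ => hderiv s) hneg hlim).neg
  rw [integral_neg, zero_sub, neg_inj] at hval
  have hint' : IntegrableOn (fun s => Real.exp (l ^ 2 * T / 2)
          * (Real.exp (-(2 * l * s)) * supDensity l T s)) (Set.Ioi a) := by
    refine Integrable.const_mul (f := fun s => Real.exp (-(2 * l * s)) * supDensity l T s) ?_ _
    rw [← neg_neg (fun s => _ * _)]
    exact hint
  rw [← ofReal_integral_eq_lintegral_ofReal hint' (.of_forall fun s =>
    mul_nonneg (Real.exp_pos _).le
      (mul_nonneg (Real.exp_pos _).le (supDensity_nonneg hl.le T s))), integral_const_mul, hval,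
    lintegral_add_left (by fun_prop), lintegral_exp_mul_gaussianReal_Ioi _ hT]
  have : ∀ y, ENNReal.ofReal (Real.exp (-l * (2 * a - y)))
      = ENNReal.ofReal (Real.exp (-(2 * l * a))) * ENNReal.ofReal (Real.exp (l * y)) := by
    intro y
    rw [← ENNReal.ofReal_mul (Real.exp_pos _).le, ← Real.exp_add]
    congr 2; ring
  simp_rw [this]
  have hc : ∀ μ : Measure ℝ, 0 ≤ 1 - cdf μ a := fun μ => sub_nonneg.2 (cdf_le_one _ _)
  rw [lintegral_const_mul _ (by fun_prop), lintegral_exp_mul_gaussianReal_Ioi _ hT,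
    ← ENNReal.ofReal_mul (Real.exp_pos _).le, ← ENNReal.ofReal_add
      (mul_nonneg (Real.exp_pos _).le (hc _))
      (mul_nonneg (Real.exp_pos _).le (mul_nonneg (Real.exp_pos _).le (hc _)))]
  congr 1
  rw [hG, neg_sq]; ring

/-- The running supremum over a countable dense set of times. -/
def denseSup {Ω : Type*} (X : ℝ≥0 → Ω → ℝ) (t : ℝ≥0) (ω : Ω) : ℝ :=
  ⨆ n, X (min (TopologicalSpace.denseSeq ℝ≥0 n) t) ω

section Path

variable {Ω : Type*} {X : ℝ≥0 → Ω → ℝ} {ω : Ω}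

lemma bddAbove_path (h : Continuous fun s => X s ω) (t : ℝ≥0) :
    BddAbove ((fun s => X s ω) '' Set.Iic t) := by
  rw [← Set.Icc_bot]
  exact (isCompact_Icc.image h).bddAbove

lemma le_runSup (h : Continuous fun s => X s ω) {s t : ℝ≥0} (hst : s ≤ t) :
    X s ω ≤ runSup X t ω :=
  le_csSup (bddAbove_path h t) ⟨s, hst, rfl⟩

lemma lt_runSup_iff (h : Continuous fun s => X s ω) {t : ℝ≥0} {a : ℝ} :
    a < runSup X t ω ↔ ∃ s ≤ t, a < X s ω := by
  rw [runSup, lt_csSup_iff (bddAbove_path h t) ⟨_, 0, Set.mem_Iic.2 zero_le, rfl⟩]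
  simp

lemma denseSup_eq_runSup (h : Continuous fun s => X s ω) (t : ℝ≥0) :
    denseSup X t ω = runSup X t ω := by
  have hbdd : BddAbove (Set.range fun n =>
      X (min (TopologicalSpace.denseSeq ℝ≥0 n) t) ω) := by
    refine (bddAbove_path h t).mono ?_
    rintro _ ⟨n, rfl⟩
    exact ⟨_, Set.mem_Iic.2 (min_le_right _ _), rfl⟩
  refine le_antisymm (ciSup_le fun n => le_runSup h (min_le_right _ _)) ?_
  refine csSup_le ⟨_, 0, Set.mem_Iic.2 zero_le, rfl⟩ ?_
  rintro _ ⟨s, hs, rfl⟩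
  have hclosed : IsClosed {r : ℝ≥0 | X (min r t) ω ≤ denseSup X t ω} :=
    isClosed_le (h.comp (continuous_id.min continuous_const)) continuous_const
  have : s ∈ {r : ℝ≥0 | X (min r t) ω ≤ denseSup X t ω} :=
    (TopologicalSpace.denseRange_denseSeq ℝ≥0).induction_on s hclosed fun n => le_ciSup hbdd n
  simpa [min_eq_left (Set.mem_Iic.1 hs)] using this

lemma runSup_add (h : Continuous fun s => X s ω) (u T : ℝ≥0) :
    runSup X (u + T) ω
      = max (runSup X u ω) (X u ω + runSup (fun r ω => X (u + r) ω - X u ω) T ω) := by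
  have h' : Continuous fun r => X (u + r) ω - X u ω := by fun_prop
  refine eq_of_forall_lt_iff fun c => ?_
  rw [lt_runSup_iff h, lt_max_iff, lt_runSup_iff h, ← sub_lt_iff_lt_add',
    lt_runSup_iff (X := fun r ω => X (u + r) ω - X u ω) h']
  constructor
  · rintro ⟨s, hs, hc⟩
    rcases le_total s u with hsu | hsu
    · exact .inl ⟨s, hsu, hc⟩
    · refine .inr ⟨s - u, tsub_le_iff_left.2 hs, ?_⟩
      simpa [add_tsub_cancel_of_le hsu] using hc
  · rintro (⟨s, hs, hc⟩ | ⟨r, hr, hc⟩)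
    · exact ⟨s, hs.trans le_self_add, hc⟩
    · exact ⟨u + r, by gcongr, by simpa using hc⟩

lemma runSup_zero : runSup X 0 ω = X 0 ω := by
  have : Set.Iic (0 : ℝ≥0) = {0} := by ext; simp
  simp [runSup, this]

end Path

/-- The first point at which a path sampled on the grid `T * k / (n + 1)` exceeds the level `a`
converges to `a` as the mesh vanishes. -/
lemma tendsto_sum_first_passage {y : ℝ≥0 → ℝ} (hy : Continuous y) {a : ℝ} (h0 : y 0 ≤ a)
    (T : ℝ≥0) {g : ℝ → ℝ} (hg : ContinuousAt g a) :
    Tendsto (fun n : ℕ => ∑ k ∈ Finset.range (n + 2),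
        {k : ℕ | a < y (T * (k / (n + 1))) ∧ ∀ j < k, y (T * (j / (n + 1))) ≤ a}.indicator
          (fun k : ℕ => g (y (T * (k / (n + 1))))) k) atTop
      (𝓝 ({b : ℝ | ∃ s ≤ T, b < y s}.indicator g a)) := by
  have hgrid : ∀ n k : ℕ, k ≤ n + 1 → T * ((k : ℝ≥0) / (n + 1)) ≤ T := by
    intro n k hk
    refine mul_le_of_le_one_right zero_le (div_le_one_of_le₀ (by exact_mod_cast hk) zero_le)
  by_cases hex : ∃ s ≤ T, a < y s
  · rw [Set.indicator_of_mem (by exact hex)]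
    obtain ⟨r, hrT, hr⟩ := hex
    rw [Metric.tendsto_atTop]
    intro ε hε
    obtain ⟨δ, hδ, hgδ⟩ := Metric.continuousAt_iff.1 hg ε hε
    have hunif : UniformContinuousOn y (Set.Icc 0 T) :=
      isCompact_Icc.uniformContinuousOn_of_continuous hy.continuousOn
    obtain ⟨η, hη, hyη⟩ := Metric.uniformContinuousOn_iff.1 hunif (min δ (y r - a))
      (lt_min hδ (sub_pos.2 hr))
    have hTpos : 0 < T := by
      rcases eq_or_ne T 0 with rfl | hT
      · rw [nonpos_iff_eq_zero.1 hrT] at hr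
        exact absurd hr h0.not_gt
      · exact pos_iff_ne_zero.2 hT
    have hTR : (0 : ℝ) < T := hTpos
    obtain ⟨N, hN⟩ := exists_nat_gt ((T : ℝ) / η)
    refine ⟨N, fun n hn => ?_⟩
    have hn1 : (0 : ℝ) < n + 1 := by positivity
    have hmesh : (T : ℝ) / (n + 1) < η := by
      rw [div_lt_iff₀ hη] at hN
      rw [div_lt_iff₀ hn1]
      have : (N : ℝ) ≤ n := by exact_mod_cast hn
      nlinarith
    have hexk : ∃ k : ℕ, a < y (T * (k / (n + 1))) ∧ k ≤ n + 1 := by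
      have hrR : (r : ℝ) ≤ T := hrT
      have hq : 0 ≤ (r : ℝ) * (n + 1) / T := by positivity
      have hk1 := Nat.floor_le hq
      have hk2 := Nat.lt_floor_add_one ((r : ℝ) * (n + 1) / T)
      set k := ⌊(r : ℝ) * (n + 1) / T⌋₊
      have hkn : k ≤ n + 1 := by
        have : (k : ℝ) ≤ n + 1 := by
          refine hk1.trans ?_
          rw [div_le_iff₀ hTR]
          nlinarith
        exact_mod_cast this
      refine ⟨k, ?_, hkn⟩
      have hd : dist (T * ((k : ℝ≥0) / (n + 1))) r < η := by
        rw [NNReal.dist_eq, abs_lt]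
        push_cast
        rw [le_div_iff₀ hTR] at hk1
        rw [div_lt_iff₀ hTR] at hk2
        have e1 : (T : ℝ) * (k / (n + 1)) ≤ r := by
          rw [← mul_div_assoc, div_le_iff₀ hn1]; linarith
        have e2 : (r : ℝ) < T * (k / (n + 1)) + T / (n + 1) := by
          rw [← mul_div_assoc, ← add_div, lt_div_iff₀ hn1]; linarith
        constructor <;> linarith
      have := hyη _ ⟨zero_le, hgrid n k hkn⟩ r ⟨zero_le, hrT⟩ hd
      rw [Real.dist_eq, abs_lt] at this
      linarith [min_le_right δ (y r - a)]
    classical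
    obtain ⟨hk, hkn⟩ := Nat.find_spec hexk
    set k := Nat.find hexk with hkdef
    have hmin : ∀ j < k, y (T * (j / (n + 1))) ≤ a := fun j hj => by
      by_contra! hcon
      exact Nat.find_min hexk hj ⟨hcon, hj.le.trans hkn⟩
    rw [Finset.sum_eq_single k]
    · rw [Set.indicator_of_mem (by exact ⟨hk, hmin⟩)]
      refine hgδ ?_
      have hk0 : k ≠ 0 := by
        intro h
        rw [h] at hk
        simp only [Nat.cast_zero, zero_div, mul_zero] at hk
        exact absurd hk h0.not_gt
      obtain ⟨j, hj⟩ := Nat.exists_eq_succ_of_ne_zero hk0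
      have hja := hmin j (by omega)
      have hd : dist (T * ((k : ℝ≥0) / (n + 1))) (T * ((j : ℝ≥0) / (n + 1))) < η := by
        rw [NNReal.dist_eq, hj]
        push_cast
        rw [show (T : ℝ) * ((j + 1) / (n + 1)) - T * (j / (n + 1)) = T / (n + 1) by ring,
          abs_of_pos (by positivity)]
        exact hmesh
      have := hyη _ ⟨zero_le, hgrid n k hkn⟩ _ ⟨zero_le, hgrid n j (by omega)⟩ hd
      rw [Real.dist_eq, abs_lt] at this ⊢
      have := min_le_left δ (y r - a)
      constructor <;> linarith
    · intro j _ hjk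
      refine Set.indicator_of_notMem ?_ _
      rintro ⟨h1, h2⟩
      rcases lt_or_gt_of_ne hjk with h | h
      · exact absurd h1 (hmin j h).not_gt
      · exact absurd hk (h2 k h).not_gt
    · intro h
      exact absurd (Finset.mem_range.2 (by omega)) h
  · rw [Set.indicator_of_notMem (by exact hex)]
    refine tendsto_const_nhds.congr fun n => (Finset.sum_eq_zero fun k hk => ?_).symm
    refine Set.indicator_of_notMem ?_ _
    rintro ⟨h1, -⟩
    exact hex ⟨_, hgrid n k (by have := Finset.mem_range.1 hk; omega), h1⟩

lemma abs_sum_indicator_le_of_subsingleton {ι : Type*} (I : Finset ι) {s : Set ι}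
    (hs : s.Subsingleton) {h : ι → ℝ} {C : ℝ} (hC : 0 ≤ C) (hh : ∀ i, |h i| ≤ C) :
    |∑ i ∈ I, s.indicator h i| ≤ C := by
  classical
  by_cases hex : ∃ i ∈ I, i ∈ s
  · obtain ⟨i, hi, his⟩ := hex
    rw [Finset.sum_eq_single i (fun j _ hj => Set.indicator_of_notMem
      (fun hjs => hj (hs hjs his)) _) (fun h => absurd hi h), Set.indicator_of_mem his]
    exact hh i
  · push Not at hex
    rw [Finset.sum_eq_zero fun i hi => Set.indicator_of_notMem (hex i hi) _, abs_zero]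
    exact hC

namespace IsBrownianMotion

variable {Ω : Type*} [m : MeasurableSpace Ω] {P : Measure Ω} {X : ℝ≥0 → Ω → ℝ} {x : ℝ}

lemma measurable_natFiltration (hX : IsBrownianMotion P X x) {s t : ℝ≥0} (hst : s ≤ t) :
    Measurable[natFiltration X t] (X s) := by
  rw [measurable_iff_comap_le]
  exact le_inf (le_iSup₂ (f := fun s _ => MeasurableSpace.comap (X s) Real.measurableSpace) s hst)
    (hX.stronglyMeasurable s).measurable.comap_le

lemma measurable_denseSup (hX : IsBrownianMotion P X x) (t : ℝ≥0) :
    Measurable[natFiltration X t] (denseSup X t) :=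
  Measurable.iSup fun _ => hX.measurable_natFiltration (min_le_right _ _)

lemma ae_runSup_eq_denseSup (hX : IsBrownianMotion P X x) (t : ℝ≥0) :
    runSup X t =ᵐ[P] denseSup X t := by
  filter_upwards [hX.cont] with ω hω using (denseSup_eq_runSup hω t).symm

lemma indepFun_increment (hX : IsBrownianMotion P X x) {s t : ℝ≥0} (hst : s ≤ t)
    {β : Type*} [MeasurableSpace β] {U : Ω → β} (hU : Measurable[natFiltration X s] U) :
    IndepFun U (fun ω => X t ω - X s ω) P := by
  rw [IndepFun_iff_Indep]
  exact indep_of_indep_of_le_left (hX.indep_incr s t hst).symm (measurable_iff_comap_le.1 hU)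

variable [IsProbabilityMeasure P]

/-- Given the past, a Brownian increment is symmetric. -/
lemma setIntegral_add_increment (hX : IsBrownianMotion P X x) {s t : ℝ≥0} (hst : s ≤ t)
    {A : Set Ω} (hA : MeasurableSet[natFiltration X s] A)
    {V : Ω → ℝ} (hV : Measurable[natFiltration X s] V) {f : ℝ → ℝ} (hf : Measurable f) :
    ∫ ω in A, f (V ω + (X t ω - X s ω)) ∂P = ∫ ω in A, f (V ω - (X t ω - X s ω)) ∂P := by
  have hle := (natFiltration X).le s
  set U : Ω → ℝ × ℝ := fun ω => (V ω, A.indicator 1 ω)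
  have hU : Measurable[natFiltration X s] U :=
    Measurable.prodMk hV (Measurable.indicator measurable_const hA)
  have hU' : Measurable U := hU.mono hle le_rfl
  have hW : Measurable fun ω => X t ω - X s ω :=
    (hX.stronglyMeasurable t).measurable.sub (hX.stronglyMeasurable s).measurable
  have hWn : Measurable fun ω => -(X t ω - X s ω) := hW.neg
  have hindep := hX.indepFun_increment hst hU
  have hindepn : IndepFun U (fun ω => -(X t ω - X s ω)) P :=
    hindep.comp measurable_id measurable_neg
  have hlaw : P.map (fun ω => -(X t ω - X s ω)) = P.map (fun ω => X t ω - X s ω) := by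
    have := gaussianReal_map_neg (μ := 0) (v := t - s)
    rw [← hX.gauss_incr s t hst, Measure.map_map (by fun_prop) hW, neg_zero,
      ← hX.gauss_incr s t hst] at this
    exact this
  have hjoint : P.map (fun ω => (U ω, X t ω - X s ω))
      = P.map (fun ω => (U ω, -(X t ω - X s ω))) := by
    rw [hindep.map_prod_eq_prod_map_map hU'.aemeasurable hW.aemeasurable,
      hindepn.map_prod_eq_prod_map_map hU'.aemeasurable hWn.aemeasurable, hlaw]
  set q : (ℝ × ℝ) × ℝ → ℝ := fun p => p.1.2 * f (p.1.1 + p.2)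
  have hq : Measurable q := by fun_prop
  have key : ∫ ω, q (U ω, X t ω - X s ω) ∂P = ∫ ω, q (U ω, -(X t ω - X s ω)) ∂P := by
    rw [← integral_map (φ := fun ω => (U ω, X t ω - X s ω)) (hU'.prodMk hW).aemeasurable
      hq.aestronglyMeasurable, hjoint, integral_map (hU'.prodMk hWn).aemeasurable
      hq.aestronglyMeasurable]
  rw [← integral_indicator (hle A hA), ← integral_indicator (hle A hA)]
  convert key using 2 with ω ω <;>
  · funext ω
    by_cases h : ω ∈ A <;> simp [q, U, h, sub_eq_add_neg]

/-- Reflection principle: after the first passage above `a`, the path may be reflected at `a`. -/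
lemma setIntegral_reflection (hX : IsBrownianMotion P X x) (u T : ℝ≥0)
    {Γ : Set Ω} (hΓ : MeasurableSet[natFiltration X u] Γ) {a : ℝ} (ha : 0 ≤ a)
    (f : BoundedContinuousFunction ℝ ℝ) :
    ∫ ω in Γ, {ω | a < denseSup (fun r ω => X (u + r) ω - X u ω) T ω}.indicator
        (fun ω => f (X (u + T) ω - X u ω)) ω ∂P
      = ∫ ω in Γ, {ω | a < denseSup (fun r ω => X (u + r) ω - X u ω) T ω}.indicator
        (fun ω => f (2 * a - (X (u + T) ω - X u ω))) ω ∂P := by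
  have hmX : ∀ r, Measurable (X r) := fun r => (hX.stronglyMeasurable r).measurable
  set Y : ℝ≥0 → Ω → ℝ := fun r ω => X (u + r) ω - X u ω with hY
  have hmY : ∀ r, Measurable (Y r) := fun r => (hmX _).sub (hmX _)
  have hYf : ∀ {r s}, r ≤ s → Measurable[natFiltration X (u + s)] (Y r) := fun {r s} hrs =>
    Measurable.sub (hX.measurable_natFiltration (by gcongr))
      (hX.measurable_natFiltration le_self_add)
  set A : ℕ → ℕ → Set Ω := fun n k =>
    {ω | a < Y (T * (k / (n + 1))) ω ∧ ∀ j < k, Y (T * (j / (n + 1))) ω ≤ a} with hA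
  have hAf : ∀ n k : ℕ, MeasurableSet[natFiltration X (u + T * (k / (n + 1)))] (A n k) := by
    intro n k
    refine MeasurableSet.inter (measurableSet_lt measurable_const (hYf le_rfl)) ?_
    change MeasurableSet[natFiltration X _] {ω | ∀ j < k, Y (T * (j / (n + 1))) ω ≤ a}
    have : {ω | ∀ j < k, Y (T * (j / (n + 1))) ω ≤ a}
        = ⋂ j ∈ Finset.range k, {ω | Y (T * (j / (n + 1))) ω ≤ a} := by ext; simp
    rw [this]
    refine MeasurableSet.biInter (Finset.range k).countable_toSet fun j hj => ?_
    refine measurableSet_le (hYf ?_) measurable_const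
    have : j ≤ k := (Finset.mem_range.1 hj).le
    gcongr
  have hlim : ∀ g : Ω → ℝ → ℝ, (∀ r, Measurable fun ω => g ω (Y r ω)) →
      (∀ ω r, |g ω r| ≤ ‖f‖) → (∀ ω, Continuous (g ω)) →
      Tendsto (fun n : ℕ => ∑ k ∈ Finset.range (n + 2),
        ∫ ω in Γ ∩ A n k, g ω (Y (T * (k / (n + 1))) ω) ∂P) atTop
        (𝓝 (∫ ω in Γ, {ω | a < denseSup Y T ω}.indicator (fun ω => g ω a) ω ∂P)) := by
    intro g hg hgb hgc
    have hsum : ∀ n : ℕ, ∑ k ∈ Finset.range (n + 2),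
        ∫ ω in Γ ∩ A n k, g ω (Y (T * (k / (n + 1))) ω) ∂P
        = ∫ ω in Γ, ∑ k ∈ Finset.range (n + 2),
          (A n k).indicator (fun ω => g ω (Y (T * (k / (n + 1))) ω)) ω ∂P := by
      intro n
      have hAm := fun k => (natFiltration X).le _ _ (hAf n k)
      rw [integral_finsetSum]
      · refine Finset.sum_congr rfl fun k _ => ?_
        rw [integral_indicator (hAm k), Measure.restrict_restrict (hAm k), Set.inter_comm]
      · intro k _
        refine Integrable.indicator ?_ (hAm k)
        exact Integrable.of_bound (hg _).aestronglyMeasurable ‖f‖ (.of_forall fun ω => hgb _ _)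
    simp_rw [hsum]
    refine tendsto_integral_of_dominated_convergence (fun _ => ‖f‖) (fun n => ?_)
      (integrable_const _) (fun n => .of_forall fun ω => ?_) ?_
    · refine Measurable.aestronglyMeasurable (Finset.measurable_fun_sum _ fun k _ => ?_)
      exact (hg _).indicator ((natFiltration X).le _ _ (hAf n k))
    · have hs : {k : ℕ | ω ∈ A n k}.Subsingleton := by
        rintro k ⟨hk1, hk2⟩ j ⟨hj1, hj2⟩
        rcases lt_trichotomy k j with h | h | h
        · exact absurd hk1 (hj2 k h).not_gt
        · exact h
        · exact absurd hj1 (hk2 j h).not_gt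
      exact abs_sum_indicator_le_of_subsingleton (Finset.range (n + 2)) hs
        (h := fun k : ℕ => g ω (Y (T * (k / (n + 1))) ω)) (norm_nonneg f) fun k => hgb _ _
    · refine ae_restrict_of_ae ?_
      filter_upwards [hX.cont] with ω hω
      have hYc : Continuous fun r => Y r ω := by
        simp only [hY]; fun_prop
      have h0 : Y 0 ω ≤ a := by simpa [hY] using ha
      have := tendsto_sum_first_passage hYc h0 T (hgc ω).continuousAt
      have hiff : a < denseSup Y T ω ↔ ∃ s ≤ T, a < Y s ω := by
        rw [denseSup_eq_runSup hYc, lt_runSup_iff hYc]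
      have hind : {ω | a < denseSup Y T ω}.indicator (fun ω => g ω a) ω
          = {b : ℝ | ∃ s ≤ T, b < Y s ω}.indicator (g ω) a := by
        by_cases h : a < denseSup Y T ω
        · rw [Set.indicator_of_mem (by exact h), Set.indicator_of_mem (by exact hiff.1 h)]
        · rw [Set.indicator_of_notMem (by exact h),
            Set.indicator_of_notMem (by exact fun h' => h (hiff.2 h'))]
      rw [hind]
      exact this
  have h1 := hlim (fun ω _ => f (Y T ω)) (fun r => f.continuous.measurable.comp (hmY T))
    (fun ω r => f.norm_coe_le_norm _) (fun ω => continuous_const)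
  have h2 := hlim (fun ω r => f (2 * r - Y T ω))
    (fun r => f.continuous.measurable.comp (((hmY r).const_mul 2).sub (hmY T)))
    (fun ω r => f.norm_coe_le_norm _) (fun ω => f.continuous.comp (by fun_prop))
  refine tendsto_nhds_unique h1 (h2.congr fun n => Finset.sum_congr rfl fun k hk => ?_)
  set s : ℝ≥0 := T * (k / (n + 1)) with hs
  have hsT : s ≤ T := by
    refine mul_le_of_le_one_right zero_le (div_le_one_of_le₀ ?_ zero_le)
    have := Finset.mem_range.1 hk
    exact_mod_cast (by omega : k ≤ n + 1)
  have hmono := (natFiltration X).mono (le_self_add : u ≤ u + s)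
  have := hX.setIntegral_add_increment (s := u + s) (t := u + T) (by gcongr)
    (MeasurableSet.inter (hmono _ hΓ) (hAf n k)) (hYf (le_refl s)) f.continuous.measurable
  have e1 : ∀ ω, Y s ω + (X (u + T) ω - X (u + s) ω) = Y T ω := fun ω => by
    simp only [hY]; ring
  have e2 : ∀ ω, Y s ω - (X (u + T) ω - X (u + s) ω) = 2 * Y s ω - Y T ω := fun ω => by
    simp only [hY]; ring
  simp_rw [e1, e2] at this
  exact this.symm

end IsBrownianMotion

lemma measure_eq_of_Ioi_of_nonneg {μ ν : Measure ℝ} [IsFiniteMeasure μ]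
    (h : ∀ a, 0 ≤ a → μ (Set.Ioi a) = ν (Set.Ioi a))
    (hμ : μ (Set.Iic 0) = 0) (hν : ν (Set.Iic 0) = 0) : μ = ν := by
  have huniv : ∀ ρ : Measure ℝ, ρ (Set.Iic 0) = 0 → ρ Set.univ = ρ (Set.Ioi 0) := fun ρ hρ => by
    refine le_antisymm ?_ (measure_mono (Set.subset_univ _))
    rw [← Set.Iic_union_Ioi (a := (0 : ℝ))]
    exact (measure_union_le _ _).trans (by rw [hρ, zero_add])
  have hmass : μ Set.univ = ν Set.univ := by rw [huniv μ hμ, huniv ν hν, h 0 le_rfl]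
  have : IsFiniteMeasure ν := ⟨hmass ▸ measure_lt_top μ _⟩
  refine Measure.ext_of_Iic μ ν fun a => ?_
  rcases le_or_gt 0 a with ha | ha
  · rw [← compl_compl (Set.Iic a), measure_compl (measurableSet_Iic.compl) (measure_ne_top _ _),
      measure_compl (measurableSet_Iic.compl) (measure_ne_top _ _), Set.compl_Iic, hmass, h a ha]
  · rw [measure_mono_null (Set.Iic_subset_Iic.2 ha.le) hμ,
      measure_mono_null (Set.Iic_subset_Iic.2 ha.le) hν]

namespace IsBrownianMotion

variable {Ω : Type*} [m : MeasurableSpace Ω] {P : Measure Ω} {X : ℝ≥0 → Ω → ℝ} {x : ℝ}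

lemma measurable_sub (hX : IsBrownianMotion P X x) (s t : ℝ≥0) :
    Measurable fun ω => X t ω - X s ω :=
  (hX.stronglyMeasurable t).measurable.sub (hX.stronglyMeasurable s).measurable

lemma measurable_denseSup_increment (hX : IsBrownianMotion P X x) (u T : ℝ≥0) :
    Measurable (denseSup (fun r ω => X (u + r) ω - X u ω) T) :=
  Measurable.iSup fun _ => hX.measurable_sub _ _

lemma map_restrict_increment (hX : IsBrownianMotion P X x) (u T : ℝ≥0) {Γ : Set Ω}
    (hΓ : MeasurableSet[natFiltration X u] Γ) :
    (P.restrict Γ).map (fun ω => X (u + T) ω - X u ω) = P Γ • gaussianReal 0 T := by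
  have hm := hX.measurable_sub u (u + T)
  ext B hB
  have hind := (Indep_iff _ _ _).1 (hX.indep_incr u (u + T) le_self_add) _ Γ ⟨B, hB, rfl⟩ hΓ
  have hg := hX.gauss_incr u (u + T) le_self_add
  rw [add_tsub_cancel_left] at hg
  rw [Measure.map_apply hm hB, Measure.restrict_apply (hm hB), hind, Measure.smul_apply, ← hg,
    Measure.map_apply hm hB, smul_eq_mul, mul_comm]

variable [IsProbabilityMeasure P]

lemma setLIntegral_reflection (hX : IsBrownianMotion P X x) (u T : ℝ≥0)
    {Γ : Set Ω} (hΓ : MeasurableSet[natFiltration X u] Γ) {a : ℝ} (ha : 0 ≤ a)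
    {k : ℝ → ℝ≥0∞} (hk : Measurable k) :
    ∫⁻ ω in Γ ∩ {ω | a < denseSup (fun r ω => X (u + r) ω - X u ω) T ω},
        k (X (u + T) ω - X u ω) ∂P
      = ∫⁻ ω in Γ ∩ {ω | a < denseSup (fun r ω => X (u + r) ω - X u ω) T ω},
        k (2 * a - (X (u + T) ω - X u ω)) ∂P := by
  have hm := hX.measurable_sub u (u + T)
  have hm' : Measurable fun ω => 2 * a - (X (u + T) ω - X u ω) := hm.const_sub _
  have hB : MeasurableSet {ω | a < denseSup (fun r ω => X (u + r) ω - X u ω) T ω} :=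
    measurableSet_lt measurable_const (hX.measurable_denseSup_increment u T)
  rw [← lintegral_map (f := k) hk hm, ← lintegral_map (f := k) hk hm']
  congr 1
  refine ext_of_forall_integral_eq_of_IsFiniteMeasure fun f => ?_
  rw [integral_map hm.aemeasurable f.continuous.aestronglyMeasurable,
    integral_map hm'.aemeasurable f.continuous.aestronglyMeasurable, Set.inter_comm,
    ← Measure.restrict_restrict hB, ← integral_indicator hB, ← integral_indicator hB]
  exact hX.setIntegral_reflection u T hΓ ha f

/-- Joint law of the endpoint and the running maximum of the increments after time `u`, on an
event of the past of `u`. -/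
lemma setLIntegral_lt_denseSup (hX : IsBrownianMotion P X x) (u : ℝ≥0) {T : ℝ≥0} (hT : T ≠ 0)
    {Γ : Set Ω} (hΓ : MeasurableSet[natFiltration X u] Γ) {a : ℝ} (ha : 0 ≤ a)
    {k : ℝ → ℝ≥0∞} (hk : Measurable k) :
    ∫⁻ ω in Γ ∩ {ω | a < denseSup (fun r ω => X (u + r) ω - X u ω) T ω},
        k (X (u + T) ω - X u ω) ∂P
      = P Γ * ∫⁻ y in Set.Ioi a, (k y + k (2 * a - y)) ∂gaussianReal 0 T := by
  have hm := hX.measurable_sub u (u + T)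
  set Y : Ω → ℝ := fun ω => X (u + T) ω - X u ω with hY
  set D : Ω → ℝ := denseSup (fun r ω => X (u + r) ω - X u ω) T with hD
  have hB : MeasurableSet {ω | a < D ω} :=
    measurableSet_lt measurable_const (hX.measurable_denseSup_increment u T)
  have hΓm := (natFiltration X).le _ _ hΓ
  have hmap := hX.map_restrict_increment u T hΓ
  have hne : ∀ᵐ ω ∂P, Y ω ≠ a := by
    have := nullSingletonClass_gaussianReal (μ := 0) hT
    have h0 := hX.gauss_incr u (u + T) le_self_add
    rw [add_tsub_cancel_left] at h0
    have h1 : P.map Y {a} = 0 := by rw [h0]; exact measure_singleton a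
    rw [Measure.map_apply hm (measurableSet_singleton a)] at h1
    rw [ae_iff]
    simp only [not_not]
    exact h1
  have hle : ∀ᵐ ω ∂P, Y ω ≤ D ω := by
    filter_upwards [hX.cont] with ω hω
    have hc : Continuous fun r => X (u + r) ω - X u ω := by fun_prop
    rw [hD, denseSup_eq_runSup (X := fun r ω => X (u + r) ω - X u ω) hc]
    exact le_runSup (X := fun r ω => X (u + r) ω - X u ω) hc le_rfl
  have h1 : Measurable ((Set.Ioi a).indicator k) := hk.indicator measurableSet_Ioi
  have h1Y : Measurable fun ω => (Set.Ioi a).indicator k (Y ω) := h1.comp hm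
  have h2 : Measurable ((Set.Iio a).indicator k) := hk.indicator measurableSet_Iio
  have hsplit : ∫⁻ ω in Γ ∩ {ω | a < D ω}, k (Y ω) ∂P
      = ∫⁻ ω in Γ ∩ {ω | a < D ω}, (Set.Ioi a).indicator k (Y ω) ∂P
        + ∫⁻ ω in Γ ∩ {ω | a < D ω}, (Set.Iio a).indicator k (Y ω) ∂P := by
    rw [← lintegral_add_left h1Y]
    refine lintegral_congr_ae (ae_restrict_of_ae ?_)
    filter_upwards [hne] with ω hω
    rcases lt_or_gt_of_ne hω with h | h <;> simp [h, h.not_gt]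
  have hrefl := hX.setLIntegral_reflection u T hΓ ha h2
  have hpt : ∀ y, (Set.Iio a).indicator k (2 * a - y)
      = (Set.Ioi a).indicator (fun y => k (2 * a - y)) y := by
    intro y
    by_cases h : a < y
    · have h' : 2 * a - y ∈ Set.Iio a := Set.mem_Iio.2 (by linarith)
      rw [Set.indicator_of_mem h', Set.indicator_of_mem (Set.mem_Ioi.2 h)]
    · have h' : 2 * a - y ∉ Set.Iio a := fun h'' => h (by linarith [Set.mem_Iio.1 h''])
      rw [Set.indicator_of_notMem h', Set.indicator_of_notMem (by exact h)]
  have hdrop : ∀ h : ℝ → ℝ≥0∞, ∫⁻ ω in Γ ∩ {ω | a < D ω}, (Set.Ioi a).indicator h (Y ω) ∂P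
      = ∫⁻ ω in Γ, (Set.Ioi a).indicator h (Y ω) ∂P := by
    intro h
    rw [Set.inter_comm, ← Measure.restrict_restrict hB, ← lintegral_indicator hB]
    refine lintegral_congr_ae (ae_restrict_of_ae ?_)
    filter_upwards [hle] with ω hω
    by_cases h' : a < D ω
    · rw [Set.indicator_of_mem (by exact h')]
    · rw [Set.indicator_of_notMem (by exact h'), Set.indicator_of_notMem]
      exact fun h'' => h' (lt_of_lt_of_le h'' hω)
  have hk2 : Measurable fun y => k (2 * a - y) := hk.comp (measurable_id.const_sub _)
  rw [hsplit, hrefl]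
  simp_rw [hpt]
  rw [hdrop, hdrop, ← lintegral_add_left h1Y, ← lintegral_indicator measurableSet_Ioi,
    ← smul_eq_mul (P Γ), ← lintegral_smul_measure, ← hmap, lintegral_map _ hm]
  · refine lintegral_congr fun ω => ?_
    by_cases h : a < Y ω <;> simp [h]
  · exact (hk.add hk2).indicator measurableSet_Ioi

lemma ae_denseSup_increment_pos (hX : IsBrownianMotion P X x) (u : ℝ≥0) {T : ℝ≥0} (hT : T ≠ 0) :
    ∀ᵐ ω ∂P, 0 < denseSup (fun r ω => X (u + r) ω - X u ω) T ω := by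
  have h := hX.setLIntegral_lt_denseSup u hT (Γ := Set.univ) MeasurableSet.univ le_rfl
    (k := fun _ => 1) measurable_const
  have := nullSingletonClass_gaussianReal (μ := 0) hT
  have hsymm : gaussianReal 0 T (Set.Iio 0) = gaussianReal 0 T (Set.Ioi 0) := by
    have := gaussianReal_map_neg (μ := 0) (v := T)
    rw [neg_zero] at this
    conv_lhs => rw [← this]
    rw [Measure.map_apply measurable_neg measurableSet_Iio]
    simp
  have hone : gaussianReal 0 T (Set.Ioi 0) + gaussianReal 0 T (Set.Ioi 0) = 1 := by
    nth_rw 1 [← hsymm]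
    rw [measure_congr Iio_ae_eq_Iic, ← measure_union (Set.Iic_disjoint_Ioi le_rfl)
      measurableSet_Ioi, Set.Iic_union_Ioi, measure_univ]
  have h1 : P {ω | 0 < denseSup (fun r ω => X (u + r) ω - X u ω) T ω} = 1 := by
    simpa [mul_add, two_mul, add_mul, one_add_one_eq_two.symm, hone] using h
  exact (prob_compl_eq_zero_iff (measurableSet_lt measurable_const
    (hX.measurable_denseSup_increment u T))).2 h1

end IsBrownianMotion

/-- The law of the running maximum at time `T` of a Brownian motion started at `0`, weighted by
`exp (-(l * X_T))`. -/
def supMeasure (l : ℝ) (T : ℝ≥0) : Measure ℝ :=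
  (volume.restrict (Set.Ioi 0)).withDensity fun s =>
    ENNReal.ofReal (Real.exp (l ^ 2 * T / 2) * (Real.exp (-(2 * l * s)) * supDensity l T s))

namespace IsBrownianMotion

variable {Ω : Type*} [m : MeasurableSpace Ω] {P : Measure Ω} {X : ℝ≥0 → Ω → ℝ} {x : ℝ}
  [IsProbabilityMeasure P]

lemma map_denseSup_increment (hX : IsBrownianMotion P X x) (u : ℝ≥0) {T : ℝ≥0} (hT : T ≠ 0)
    {l : ℝ} (hl : 0 < l) {Γ : Set Ω} (hΓ : MeasurableSet[natFiltration X u] Γ) :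
    ((P.restrict Γ).withDensity fun ω =>
        ENNReal.ofReal (Real.exp (-l * (X (u + T) ω - X u ω)))).map
      (denseSup (fun r ω => X (u + r) ω - X u ω) T) = P Γ • supMeasure l T := by
  have hm := hX.measurable_sub u (u + T)
  have hD := hX.measurable_denseSup_increment u T
  have hpos := hX.ae_denseSup_increment_pos u hT
  set Y : Ω → ℝ := fun ω => X (u + T) ω - X u ω with hY
  set D : Ω → ℝ := denseSup (fun r ω => X (u + r) ω - X u ω) T with hDdef
  have hk : Measurable fun y : ℝ => ENNReal.ofReal (Real.exp (-l * y)) := by fun_prop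
  have hfin : IsFiniteMeasure ((P.restrict Γ).withDensity fun ω =>
      ENNReal.ofReal (Real.exp (-l * Y ω))) := by
    refine isFiniteMeasure_withDensity ?_
    have := lintegral_map (μ := P.restrict Γ) hk hm
    rw [← this, hX.map_restrict_increment u T hΓ, lintegral_smul_measure, smul_eq_mul]
    refine ENNReal.mul_ne_top (measure_ne_top _ _) ?_
    exact (integrable_exp_mul_gaussianReal (-l)).lintegral_lt_top.ne
  refine measure_eq_of_Ioi_of_nonneg (fun a ha => ?_) ?_ ?_
  · have hB : MeasurableSet (D ⁻¹' Set.Ioi a) := hD measurableSet_Ioi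
    rw [Measure.map_apply hD measurableSet_Ioi, withDensity_apply _ hB,
      Measure.restrict_restrict hB, Set.inter_comm, Measure.smul_apply, smul_eq_mul, supMeasure,
      withDensity_apply _ measurableSet_Ioi, Measure.restrict_restrict measurableSet_Ioi,
      Set.inter_eq_self_of_subset_left (Set.Ioi_subset_Ioi ha),
      ← lintegral_reflection_eq_supDensity hl hT]
    exact hX.setLIntegral_lt_denseSup u hT hΓ ha hk
  · rw [Measure.map_apply hD measurableSet_Iic]
    refine (withDensity_absolutelyContinuous _ _).trans
      Measure.restrict_le_self.absolutelyContinuous ?_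
    refine measure_mono_null ?_ (ae_iff.1 hpos)
    intro ω h
    exact not_lt.2 h
  · rw [Measure.smul_apply, supMeasure, withDensity_apply _ measurableSet_Iic,
      Measure.restrict_restrict measurableSet_Iic, Set.Iic_inter_Ioi, Set.Ioc_self]
    simp

/-- The past of `u`, seen through an adapted variable, and the running maximum of the increments
after `u` are independent under the law weighted by `exp (-(l * (X_{u + T} - X_u)))`. -/
lemma setLIntegral_denseSup_increment (hX : IsBrownianMotion P X x) (u : ℝ≥0) {T : ℝ≥0}
    (hT : T ≠ 0) {l : ℝ} (hl : 0 < l) {Γ : Set Ω} (hΓ : MeasurableSet[natFiltration X u] Γ)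
    {β : Type*} [MeasurableSpace β] {Z : Ω → β} (hZ : Measurable[natFiltration X u] Z)
    {F : β × ℝ → ℝ≥0∞} (hF : Measurable F) :
    ∫⁻ ω in Γ, ENNReal.ofReal (Real.exp (-l * (X (u + T) ω - X u ω)))
        * F (Z ω, denseSup (fun r ω => X (u + r) ω - X u ω) T ω) ∂P
      = ∫⁻ p, F p ∂((P.restrict Γ).map Z).prod (supMeasure l T) := by
  have hm := hX.measurable_sub u (u + T)
  have hD := hX.measurable_denseSup_increment u T
  set D : Ω → ℝ := denseSup (fun r ω => X (u + r) ω - X u ω) T with hDdef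
  have hle := (natFiltration X).le u
  have hZ' : Measurable Z := hZ.mono hle le_rfl
  have hk : Measurable fun ω => ENNReal.ofReal (Real.exp (-l * (X (u + T) ω - X u ω))) := by
    fun_prop
  have : SigmaFinite (supMeasure l T) := by
    unfold supMeasure
    exact SigmaFinite.withDensity_ofReal _
  have hprod : ((P.restrict Γ).map Z).prod (supMeasure l T)
      = ((P.restrict Γ).withDensity fun ω =>
        ENNReal.ofReal (Real.exp (-l * (X (u + T) ω - X u ω)))).map fun ω => (Z ω, D ω) := by
    refine Measure.prod_eq fun A B hA hB => ?_
    rw [Measure.map_apply (hZ'.prodMk hD) (hA.prod hB), Measure.map_apply hZ' hA,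
      Measure.restrict_apply (hZ' hA)]
    have h1 := hX.map_denseSup_increment u hT hl (MeasurableSet.inter (hZ hA) hΓ)
    have h2 := congrArg (fun μ => μ B) h1
    simp only [Measure.smul_apply, smul_eq_mul] at h2
    rw [← h2, Measure.map_apply hD hB, withDensity_apply _ ((hZ'.prodMk hD) (hA.prod hB)),
      withDensity_apply _ (hD hB), Measure.restrict_restrict ((hZ'.prodMk hD) (hA.prod hB)),
      Measure.restrict_restrict (hD hB)]
    congr 2
    ext ω
    simp only [Set.mem_inter_iff, Set.mem_preimage, Set.mem_prod]
    tauto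
  have hFZ : Measurable fun ω => F (Z ω, D ω) := hF.comp (hZ'.prodMk hD)
  rw [hprod, lintegral_map hF (hZ'.prodMk hD), lintegral_withDensity_eq_lintegral_mul _ hk hFZ]
  rfl

end IsBrownianMotion

/-- The density of the Kennedy martingale as a function of the running maximum `p.1` and the
current value `p.2`. -/
def kennedyDensity (l : ℝ) (ψ : ℝ → ℝ) (p : ℝ × ℝ) : ℝ :=
  ψ p.1 * Real.sinh (l * (p.1 - p.2)) / l
    + Real.exp (l * p.2) * ∫ z in Set.Ici p.1, ψ z * Real.exp (-(l * z))

/-- The penalization weight when the running maximum is `p.1.1` and the value is `p.1.2` at some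
time, and the later increments have maximum `p.2`, stripped of the factor `exp (-(l * Y))` where
`Y` is the later increment, and multiplied by `exp (-(2 * l * p.2))`. -/
def maxWeight (l : ℝ) (ψ : ℝ → ℝ) (p : (ℝ × ℝ) × ℝ) : ℝ :=
  ψ (max p.1.1 (p.1.2 + p.2)) * Real.exp (l * (max p.1.1 (p.1.2 + p.2) - p.1.2))
    * Real.exp (-(2 * l * p.2))

section Weight

variable {l : ℝ} {ψ : ℝ → ℝ}

lemma measurable_kennedyDensity (hψ : Measurable ψ) (hψ0 : ∀ z, 0 ≤ ψ z)
    (hint : ∀ y, IntegrableOn (fun z => ψ z * Real.exp (-(l * z))) (Set.Ici y)) :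
    Measurable (kennedyDensity l ψ) := by
  have hanti : Antitone fun y => ∫ z in Set.Ici y, ψ z * Real.exp (-(l * z)) := fun a b hab =>
    setIntegral_mono_set (hint a)
      (.of_forall fun z => mul_nonneg (hψ0 z) (Real.exp_pos _).le)
      (Set.Ici_subset_Ici.2 hab).eventuallyLE
  have htail : Measurable fun p : ℝ × ℝ => ∫ z in Set.Ici p.1, ψ z * Real.exp (-(l * z)) :=
    hanti.measurable.comp measurable_fst
  exact Measurable.add (by fun_prop) (Measurable.mul (by fun_prop) htail)

lemma kennedyDensity_nonneg (hl : 0 < l) (hψ0 : ∀ z, 0 ≤ ψ z) {p : ℝ × ℝ} (hp : p.2 ≤ p.1) :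
    0 ≤ kennedyDensity l ψ p := by
  have h1 : 0 ≤ Real.sinh (l * (p.1 - p.2)) :=
    Real.sinh_nonneg_iff.2 (mul_nonneg hl.le (sub_nonneg.2 hp))
  have h2 : 0 ≤ ∫ z in Set.Ici p.1, ψ z * Real.exp (-(l * z)) :=
    integral_nonneg fun z => mul_nonneg (hψ0 z) (Real.exp_pos _).le
  have h3 := hψ0 p.1
  unfold kennedyDensity
  positivity

lemma kennedyDensity_diag (l : ℝ) (ψ : ℝ → ℝ) (y : ℝ) : kennedyDensity l ψ (y, y)
    = Real.exp (l * y) * ∫ z in Set.Ici y, ψ z * Real.exp (-(l * z)) := by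
  simp [kennedyDensity]

lemma measurable_maxWeight (l : ℝ) (hψ : Measurable ψ) : Measurable (maxWeight l ψ) := by
  unfold maxWeight
  fun_prop

lemma maxWeight_nonneg (l : ℝ) (hψ0 : ∀ z, 0 ≤ ψ z) (p : (ℝ × ℝ) × ℝ) : 0 ≤ maxWeight l ψ p :=
  mul_nonneg (mul_nonneg (hψ0 _) (Real.exp_pos _).le) (Real.exp_pos _).le

lemma setLIntegral_maxWeight (hl : 0 < l) (hψ0 : ∀ z, 0 ≤ ψ z)
    (hint : ∀ y, IntegrableOn (fun z => ψ z * Real.exp (-(l * z))) (Set.Ici y))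
    {p : ℝ × ℝ} (hp : p.2 ≤ p.1) :
    ∫⁻ s in Set.Ioi 0, ENNReal.ofReal (maxWeight l ψ (p, s))
      = ENNReal.ofReal (kennedyDensity l ψ p) := by
  obtain ⟨a, b⟩ := p
  simp only at hp
  have hab : 0 ≤ a - b := sub_nonneg.2 hp
  have hlow : ∫⁻ s in Set.Ioc 0 (a - b), ENNReal.ofReal (maxWeight l ψ ((a, b), s))
      = ENNReal.ofReal (ψ a * Real.sinh (l * (a - b)) / l) := by
    have hcongr : ∫⁻ s in Set.Ioc 0 (a - b), ENNReal.ofReal (maxWeight l ψ ((a, b), s))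
        = ∫⁻ s in Set.Ioc 0 (a - b),
          ENNReal.ofReal (ψ a * Real.exp (l * (a - b)) * Real.exp (-(2 * l) * s)) := by
      refine setLIntegral_congr_fun measurableSet_Ioc fun s hs => ?_
      have : max a (b + s) = a := max_eq_left (by linarith [hs.2])
      simp only [maxWeight, this, neg_mul]
    have hii : IntervalIntegrable
        (fun s => ψ a * Real.exp (l * (a - b)) * Real.exp (-(2 * l) * s)) volume 0 (a - b) :=
      Continuous.intervalIntegrable (by fun_prop) _ _
    rw [hcongr, ← ofReal_integral_eq_lintegral_ofReal hii.1
      (.of_forall fun s => mul_nonneg (mul_nonneg (hψ0 _) (Real.exp_pos _).le)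
        (Real.exp_pos _).le), ← intervalIntegral.integral_of_le hab,
      intervalIntegral.integral_const_mul,
      intervalIntegral.integral_comp_mul_left (fun s => Real.exp s)
        (neg_ne_zero.2 (mul_pos two_pos hl).ne'), integral_exp]
    congr 1
    rw [Real.sinh_eq, mul_zero, smul_eq_mul, Real.exp_zero,
      show -(2 * l) * (a - b) = -(l * (a - b)) + -(l * (a - b)) by ring, Real.exp_add,
      Real.exp_neg]
    have := (Real.exp_pos (l * (a - b))).ne'
    field_simp
    ring
  have hhigh : ∫⁻ s in Set.Ioi (a - b), ENNReal.ofReal (maxWeight l ψ ((a, b), s))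
      = ENNReal.ofReal (Real.exp (l * b) * ∫ z in Set.Ici a, ψ z * Real.exp (-(l * z))) := by
    have hcongr : ∫⁻ s in Set.Ioi (a - b), ENNReal.ofReal (maxWeight l ψ ((a, b), s))
        = ∫⁻ s in (fun s => s + b) ⁻¹' Set.Ioi a,
          ENNReal.ofReal (Real.exp (l * b) * (ψ (s + b) * Real.exp (-(l * (s + b))))) := by
      rw [Set.preimage_add_const_Ioi]
      refine setLIntegral_congr_fun measurableSet_Ioi fun s hs => ?_
      have : max a (b + s) = b + s := max_eq_right (by linarith [Set.mem_Ioi.1 hs])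
      simp only [maxWeight, this]
      congr 1
      rw [mul_assoc, ← Real.exp_add, add_comm s b, mul_left_comm, ← Real.exp_add]
      congr 2
      ring
    have hi := ((hint a).mono_set Set.Ioi_subset_Ici_self).const_mul (Real.exp (l * b))
    rw [hcongr, (measurePreserving_add_right volume b).setLIntegral_comp_preimage_emb
        (MeasurableEquiv.addRight b).measurableEmbedding
        (fun z => ENNReal.ofReal (Real.exp (l * b) * (ψ z * Real.exp (-(l * z))))),
      ← ofReal_integral_eq_lintegral_ofReal hi
        (.of_forall fun z => mul_nonneg (Real.exp_pos _).le
          (mul_nonneg (hψ0 _) (Real.exp_pos _).le)),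
      integral_const_mul, integral_Ici_eq_integral_Ioi]
  rw [← Set.Ioc_union_Ioi_eq_Ioi hab, lintegral_union measurableSet_Ioi
    (Set.disjoint_left.2 fun s hs hs' => (Set.mem_Ioi.1 hs').not_ge hs.2), hlow, hhigh,
    ← ENNReal.ofReal_add]
  · rfl
  · have := Real.sinh_nonneg_iff.2 (mul_nonneg hl.le hab)
    have := hψ0 a
    positivity
  · exact mul_nonneg (Real.exp_pos _).le
      (integral_nonneg fun z => mul_nonneg (hψ0 z) (Real.exp_pos _).le)

end Weight

namespace IsBrownianMotion

variable {Ω : Type*} [m : MeasurableSpace Ω] {P : Measure Ω} {X : ℝ≥0 → Ω → ℝ} {x : ℝ}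
  {l : ℝ} {ψ : ℝ → ℝ}

lemma measurable_denseSup_prodMk (hX : IsBrownianMotion P X x) (u : ℝ≥0) :
    Measurable[natFiltration X u] fun ω => (denseSup X u ω, X u ω) :=
  Measurable.prodMk (hX.measurable_denseSup u) (hX.measurable_natFiltration le_rfl)

lemma ae_le_denseSup (hX : IsBrownianMotion P X x) (u : ℝ≥0) :
    ∀ᵐ ω ∂P, X u ω ≤ denseSup X u ω := by
  filter_upwards [hX.cont] with ω hω
  rw [denseSup_eq_runSup hω]
  exact le_runSup hω le_rfl

lemma lintegral_maxWeight (hX : IsBrownianMotion P X x) (u : ℝ≥0) (hl : 0 < l)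
    (hψ : Measurable ψ) (hψ0 : ∀ z, 0 ≤ ψ z)
    (hint : ∀ y, IntegrableOn (fun z => ψ z * Real.exp (-(l * z))) (Set.Ici y))
    (Γ : Set Ω) :
    ∫⁻ p, ENNReal.ofReal (maxWeight l ψ p)
        ∂((P.restrict Γ).map fun ω => (denseSup X u ω, X u ω)).prod (volume.restrict (Set.Ioi 0))
      = ∫⁻ ω in Γ, ENNReal.ofReal (kennedyDensity l ψ (denseSup X u ω, X u ω)) ∂P := by
  have hw := measurable_maxWeight l hψ
  have hZ := (hX.measurable_denseSup_prodMk u).mono ((natFiltration X).le u) le_rfl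
  have hwl : Measurable fun q : ℝ × ℝ =>
      ∫⁻ s in Set.Ioi 0, ENNReal.ofReal (maxWeight l ψ (q, s)) :=
    Measurable.lintegral_prod_right' (f := fun p => ENNReal.ofReal (maxWeight l ψ p)) (by fun_prop)
  rw [lintegral_prod _ (by fun_prop), lintegral_map hwl hZ]
  refine lintegral_congr_ae (ae_restrict_of_ae ?_)
  filter_upwards [hX.ae_le_denseSup u] with ω hω
  exact setLIntegral_maxWeight hl hψ0 hint hω

variable [IsProbabilityMeasure P]

lemma setLIntegral_weight (hX : IsBrownianMotion P X x) (u : ℝ≥0) {T : ℝ≥0} (hT : T ≠ 0)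
    (hl : 0 < l) (hψ : Measurable ψ) (hψ0 : ∀ z, 0 ≤ ψ z) {Γ : Set Ω}
    (hΓ : MeasurableSet[natFiltration X u] Γ) :
    ∫⁻ ω in Γ, ENNReal.ofReal (ψ (runSup X (u + T) ω)
        * Real.exp (l * (runSup X (u + T) ω - X (u + T) ω))) ∂P
      = ENNReal.ofReal (Real.exp (l ^ 2 * T / 2))
        * ∫⁻ p, ENNReal.ofReal (maxWeight l ψ p) * ENNReal.ofReal (supDensity l T p.2)
          ∂((P.restrict Γ).map fun ω => (denseSup X u ω, X u ω)).prod
            (volume.restrict (Set.Ioi 0)) := by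
  have hw := measurable_maxWeight l hψ
  have hd : Measurable fun p : (ℝ × ℝ) × ℝ => supDensity l T p.2 :=
    (measurable_supDensity l T).comp measurable_snd
  set F : (ℝ × ℝ) × ℝ → ℝ≥0∞ := fun p =>
    ENNReal.ofReal (maxWeight l ψ p * Real.exp (2 * l * p.2)) with hF
  have hFm : Measurable F := by fun_prop
  have hgm : Measurable fun s => ENNReal.ofReal
      (Real.exp (l ^ 2 * T / 2) * (Real.exp (-(2 * l * s)) * supDensity l T s)) := by
    have := measurable_supDensity l T
    fun_prop
  have hgm' : Measurable fun p : (ℝ × ℝ) × ℝ => ENNReal.ofReal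
      (Real.exp (l ^ 2 * T / 2) * (Real.exp (-(2 * l * p.2)) * supDensity l T p.2)) := by
    fun_prop
  have key := hX.setLIntegral_denseSup_increment u hT hl hΓ (hX.measurable_denseSup_prodMk u) hFm
  rw [supMeasure, prod_withDensity_right hgm,
    lintegral_withDensity_eq_lintegral_mul _ hgm' hFm] at key
  rw [← lintegral_const_mul _ (by fun_prop)]
  calc
    _ = _ := lintegral_congr_ae (ae_restrict_of_ae ?_)
    _ = _ := key
    _ = _ := lintegral_congr fun p => ?_
  · filter_upwards [hX.cont] with ω hω
    have hc : Continuous fun r => X (u + r) ω - X u ω := by fun_prop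
    rw [runSup_add hω, denseSup_eq_runSup hω,
      denseSup_eq_runSup (X := fun r ω => X (u + r) ω - X u ω) hc,
      ← ENNReal.ofReal_mul (Real.exp_pos _).le]
    congr 1
    simp only [maxWeight]
    generalize runSup (fun r ω => X (u + r) ω - X u ω) T ω = s
    generalize max (runSup X u ω) (X u ω + s) = S
    rw [show l * (S - X (u + T) ω) = l * (S - X u ω) + -l * (X (u + T) ω - X u ω) by ring,
      Real.exp_add, Real.exp_neg (2 * l * s)]
    have := (Real.exp_pos (2 * l * s)).ne'
    field_simp
  · simp only [Pi.mul_apply, hF]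
    have h1 := supDensity_nonneg hl.le T p.2
    have h2 := maxWeight_nonneg l hψ0 p
    rw [← ENNReal.ofReal_mul h2, ← ENNReal.ofReal_mul (Real.exp_pos _).le,
      ← ENNReal.ofReal_mul (by positivity), Real.exp_neg (2 * l * p.2)]
    congr 1
    have := (Real.exp_pos (2 * l * p.2)).ne'
    field_simp

lemma lintegral_kennedyDensity_zero (hX : IsBrownianMotion P X x) :
    ∫⁻ ω, ENNReal.ofReal (kennedyDensity l ψ (denseSup X 0 ω, X 0 ω)) ∂P
      = ENNReal.ofReal (kennedyDensity l ψ (x, x)) := by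
  have : ∀ᵐ ω ∂P, ENNReal.ofReal (kennedyDensity l ψ (denseSup X 0 ω, X 0 ω))
      = ENNReal.ofReal (kennedyDensity l ψ (x, x)) := by
    filter_upwards [hX.init, hX.cont] with ω h0 hω
    rw [denseSup_eq_runSup hω, runSup_zero, h0]
  rw [lintegral_congr_ae this, lintegral_const, measure_univ, mul_one]

lemma lintegral_maxWeight_mul_supDensity_le (hX : IsBrownianMotion P X x) (u : ℝ≥0) {T : ℝ≥0}
    (hT : 1 ≤ T) (hl : 0 < l) (hψ : Measurable ψ) (hψ0 : ∀ z, 0 ≤ ψ z)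
    (hint : ∀ y, IntegrableOn (fun z => ψ z * Real.exp (-(l * z))) (Set.Ici y)) :
    ∫⁻ p, ENNReal.ofReal (maxWeight l ψ p) * ENNReal.ofReal (supDensity l T p.2)
        ∂((P.restrict Set.univ).map fun ω => (denseSup X u ω, X u ω)).prod
          (volume.restrict (Set.Ioi 0))
      ≤ ENNReal.ofReal (Real.exp (l ^ 2 * u / 2))
        * (ENNReal.ofReal (kennedyDensity l ψ (x, x)) * ENNReal.ofReal (2 * l + 2)) := by
  have hw := measurable_maxWeight l hψ
  have hT0 : T ≠ 0 := (zero_lt_one.trans_le hT).ne'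
  have huT : 1 ≤ u + T := hT.trans le_add_self
  have h1 := hX.setLIntegral_weight u hT0 hl hψ hψ0 (Γ := Set.univ) MeasurableSet.univ
  have h2 := hX.setLIntegral_weight 0 (T := u + T) (zero_lt_one.trans_le huT).ne' hl hψ hψ0
    (Γ := Set.univ) MeasurableSet.univ
  rw [zero_add, h1] at h2
  have h3 : ∫⁻ p, ENNReal.ofReal (maxWeight l ψ p) * ENNReal.ofReal (supDensity l (u + T) p.2)
        ∂((P.restrict Set.univ).map fun ω => (denseSup X 0 ω, X 0 ω)).prod
          (volume.restrict (Set.Ioi 0))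
      ≤ ENNReal.ofReal (kennedyDensity l ψ (x, x)) * ENNReal.ofReal (2 * l + 2) := by
    rw [← hX.lintegral_kennedyDensity_zero (l := l) (ψ := ψ), ← setLIntegral_univ (μ := P),
      ← hX.lintegral_maxWeight 0 hl hψ hψ0 hint, ← lintegral_mul_const _ (by fun_prop)]
    refine lintegral_mono fun p => ?_
    gcongr
    exact supDensity_le hl.le huT p.2
  have hexp : ENNReal.ofReal (Real.exp (l ^ 2 * (u + T : ℝ≥0) / 2))
      = ENNReal.ofReal (Real.exp (l ^ 2 * T / 2)) * ENNReal.ofReal (Real.exp (l ^ 2 * u / 2)) := by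
    rw [← ENNReal.ofReal_mul (Real.exp_pos _).le, ← Real.exp_add]
    congr 2
    push_cast
    ring
  rw [hexp, mul_assoc, ENNReal.mul_right_inj (by simpa using Real.exp_pos _)
    ENNReal.ofReal_ne_top] at h2
  rw [h2]
  gcongr

lemma lintegral_kennedyDensity_lt_top (hX : IsBrownianMotion P X x) (u : ℝ≥0) (hl : 0 < l)
    (hψ : Measurable ψ) (hψ0 : ∀ z, 0 ≤ ψ z)
    (hint : ∀ y, IntegrableOn (fun z => ψ z * Real.exp (-(l * z))) (Set.Ici y)) :
    ∫⁻ ω, ENNReal.ofReal (kennedyDensity l ψ (denseSup X u ω, X u ω)) ∂P < ∞ := by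
  have hw := measurable_maxWeight l hψ
  have hsd := measurable_supDensity l
  set ρ := ((P.restrict Set.univ).map fun ω => (denseSup X u ω, X u ω)).prod
    (volume.restrict (Set.Ioi (0 : ℝ))) with hρ
  set C := ENNReal.ofReal (Real.exp (l ^ 2 * u / 2))
    * (ENNReal.ofReal (kennedyDensity l ψ (x, x)) * ENNReal.ofReal (2 * l + 2)) with hC
  have hlim : ∀ p : (ℝ × ℝ) × ℝ, Tendsto (fun n : ℕ => ENNReal.ofReal (maxWeight l ψ p)
      * ENNReal.ofReal (supDensity l n p.2)) atTop
      (𝓝 (ENNReal.ofReal (maxWeight l ψ p) * ENNReal.ofReal (2 * l))) := fun p =>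
    ENNReal.Tendsto.const_mul (ENNReal.tendsto_ofReal
      ((tendsto_supDensity hl p.2).comp tendsto_natCast_atTop_atTop)) (.inr ENNReal.ofReal_ne_top)
  have hfatou : ∫⁻ p, ENNReal.ofReal (maxWeight l ψ p) * ENNReal.ofReal (2 * l) ∂ρ ≤ C := by
    calc
      _ = ∫⁻ p, liminf (fun n : ℕ => ENNReal.ofReal (maxWeight l ψ p)
          * ENNReal.ofReal (supDensity l n p.2)) atTop ∂ρ :=
        lintegral_congr fun p => (hlim p).liminf_eq.symm
      _ ≤ liminf (fun n : ℕ => ∫⁻ p, ENNReal.ofReal (maxWeight l ψ p)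
          * ENNReal.ofReal (supDensity l n p.2) ∂ρ) atTop :=
        lintegral_liminf_le fun n => by
          have : Measurable fun p : (ℝ × ℝ) × ℝ => supDensity l n p.2 :=
            (hsd n).comp measurable_snd
          fun_prop
      _ ≤ C := by
        refine liminf_le_of_frequently_le' (Eventually.frequently ?_)
        filter_upwards [eventually_ge_atTop 1] with n hn
        exact hX.lintegral_maxWeight_mul_supDensity_le u (by exact_mod_cast hn) hl hψ hψ0 hint
  rw [lintegral_mul_const _ (by fun_prop), hX.lintegral_maxWeight u hl hψ hψ0 hint,
    setLIntegral_univ] at hfatou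
  refine lt_top_iff_ne_top.2 fun htop => ?_
  rw [htop, ENNReal.top_mul (by simpa using hl), top_le_iff, hC] at hfatou
  exact ENNReal.mul_ne_top ENNReal.ofReal_ne_top
    (ENNReal.mul_ne_top ENNReal.ofReal_ne_top ENNReal.ofReal_ne_top) hfatou

/-- Renormalized by `exp (-(l ^ 2 * T / 2))`, the penalization weight at time `u + T` integrates
over an event of the past of `u` to the Kennedy density in the limit `T → ∞`. -/
lemma tendsto_setLIntegral_weight (hX : IsBrownianMotion P X x) (u : ℝ≥0) (hl : 0 < l)
    (hψ : Measurable ψ) (hψ0 : ∀ z, 0 ≤ ψ z)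
    (hint : ∀ y, IntegrableOn (fun z => ψ z * Real.exp (-(l * z))) (Set.Ici y))
    {Γ : Set Ω} (hΓ : MeasurableSet[natFiltration X u] Γ) :
    Tendsto (fun T : ℝ≥0 => ENNReal.ofReal (Real.exp (-(l ^ 2 * T / 2)))
      * ∫⁻ ω in Γ, ENNReal.ofReal (ψ (runSup X (u + T) ω)
        * Real.exp (l * (runSup X (u + T) ω - X (u + T) ω))) ∂P) atTop
      (𝓝 ((∫⁻ ω in Γ, ENNReal.ofReal (kennedyDensity l ψ (denseSup X u ω, X u ω)) ∂P)
        * ENNReal.ofReal (2 * l))) := by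
  have hw := measurable_maxWeight l hψ
  have hsd := measurable_supDensity l
  set ρ := ((P.restrict Γ).map fun ω => (denseSup X u ω, X u ω)).prod
    (volume.restrict (Set.Ioi (0 : ℝ))) with hρ
  have hfin : ∫⁻ p, ENNReal.ofReal (maxWeight l ψ p) ∂ρ ≠ ∞ := by
    rw [hX.lintegral_maxWeight u hl hψ hψ0 hint]
    exact ((setLIntegral_le_lintegral _ _).trans_lt
      (hX.lintegral_kennedyDensity_lt_top u hl hψ hψ0 hint)).ne
  have hlim : Tendsto (fun T : ℝ≥0 => ∫⁻ p, ENNReal.ofReal (maxWeight l ψ p)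
      * ENNReal.ofReal (supDensity l T p.2) ∂ρ) atTop
      (𝓝 (∫⁻ p, ENNReal.ofReal (maxWeight l ψ p) * ENNReal.ofReal (2 * l) ∂ρ)) := by
    refine tendsto_lintegral_filter_of_dominated_convergence
      (fun p => ENNReal.ofReal (maxWeight l ψ p) * ENNReal.ofReal (2 * l + 2))
      (.of_forall fun T => ?_) ?_ ?_ (.of_forall fun p => ?_)
    · have : Measurable fun p : (ℝ × ℝ) × ℝ => supDensity l T p.2 := (hsd T).comp measurable_snd
      fun_prop
    · filter_upwards [eventually_ge_atTop 1] with T hT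
      refine .of_forall fun p => ?_
      gcongr
      exact supDensity_le hl.le hT p.2
    · rw [lintegral_mul_const _ (by fun_prop)]
      exact ENNReal.mul_ne_top hfin ENNReal.ofReal_ne_top
    · exact ENNReal.Tendsto.const_mul (ENNReal.tendsto_ofReal (tendsto_supDensity hl p.2))
        (.inr ENNReal.ofReal_ne_top)
  rw [lintegral_mul_const _ (by fun_prop), hX.lintegral_maxWeight u hl hψ hψ0 hint] at hlim
  refine hlim.congr' ?_
  filter_upwards [eventually_gt_atTop 0] with T hT
  rw [hX.setLIntegral_weight u hT.ne' hl hψ hψ0 hΓ, ← mul_assoc,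
    ← ENNReal.ofReal_mul (Real.exp_pos _).le, ← Real.exp_add, neg_add_cancel, Real.exp_zero,
    ENNReal.ofReal_one, one_mul]

/-- Renormalized by `exp (-(l ^ 2 * t / 2))`, the penalization weight at time `t` integrates over
an event of the past of `u` to the Kennedy martingale in the limit `t → ∞`. -/
lemma tendsto_setIntegral_weight (hX : IsBrownianMotion P X x) (u : ℝ≥0) (hl : 0 < l)
    (hψ : Measurable ψ) (hψ0 : ∀ z, 0 ≤ ψ z)
    (hint : ∀ y, IntegrableOn (fun z => ψ z * Real.exp (-(l * z))) (Set.Ici y))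
    {Γ : Set Ω} (hΓ : MeasurableSet[natFiltration X u] Γ) :
    Tendsto (fun t : ℝ≥0 => Real.exp (-(l ^ 2 * t / 2))
      * ∫ ω in Γ, ψ (runSup X t ω) * Real.exp (l * (runSup X t ω - X t ω)) ∂P) atTop
      (𝓝 (2 * l * ∫ ω in Γ, kennedyDensity l ψ (runSup X u ω, X u ω)
        * Real.exp (-(l ^ 2 * u) / 2) ∂P)) := by
  have hle := (natFiltration X).le
  have hw : ∀ t, ∫ ω in Γ, ψ (runSup X t ω) * Real.exp (l * (runSup X t ω - X t ω)) ∂P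
      = (∫⁻ ω in Γ, ENNReal.ofReal (ψ (runSup X t ω)
        * Real.exp (l * (runSup X t ω - X t ω))) ∂P).toReal := by
    intro t
    refine integral_eq_lintegral_of_nonneg_ae
      (.of_forall fun ω => mul_nonneg (hψ0 _) (Real.exp_pos _).le) ?_
    have hS := (hX.measurable_denseSup t).mono (hle t) le_rfl
    have hXt := (hX.stronglyMeasurable t).measurable
    have hmeas : Measurable fun ω =>
        ψ (denseSup X t ω) * Real.exp (l * (denseSup X t ω - X t ω)) := by
      fun_prop
    refine hmeas.aestronglyMeasurable.congr (ae_restrict_of_ae ?_)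
    filter_upwards [hX.ae_runSup_eq_denseSup t] with ω hω
    rw [hω]
  have hK : ∫ ω in Γ, kennedyDensity l ψ (runSup X u ω, X u ω) ∂P
      = (∫⁻ ω in Γ, ENNReal.ofReal (kennedyDensity l ψ (denseSup X u ω, X u ω)) ∂P).toReal := by
    rw [← integral_eq_lintegral_of_nonneg_ae]
    · refine integral_congr_ae (ae_restrict_of_ae ?_)
      filter_upwards [hX.ae_runSup_eq_denseSup u] with ω hω
      rw [hω]
    · refine ae_restrict_of_ae ?_
      filter_upwards [hX.ae_le_denseSup u] with ω hω using kennedyDensity_nonneg hl hψ0 hω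
    · exact ((measurable_kennedyDensity hψ hψ0 hint).comp
        ((hX.measurable_denseSup_prodMk u).mono (hle u) le_rfl)).aestronglyMeasurable
  have hfin : ∫⁻ ω in Γ, ENNReal.ofReal (kennedyDensity l ψ (denseSup X u ω, X u ω)) ∂P ≠ ∞ :=
    ((setLIntegral_le_lintegral _ _).trans_lt
      (hX.lintegral_kennedyDensity_lt_top u hl hψ hψ0 hint)).ne
  have hT := ((ENNReal.tendsto_toReal (ENNReal.mul_ne_top hfin ENNReal.ofReal_ne_top)).comp
    (hX.tendsto_setLIntegral_weight u hl hψ hψ0 hint hΓ)).const_mul (Real.exp (-(l ^ 2 * u) / 2))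
  have hsub : Tendsto (fun t : ℝ≥0 => t - u) atTop atTop := by
    refine tendsto_atTop.2 fun b => ?_
    filter_upwards [eventually_ge_atTop (b + u)] with t ht using le_tsub_of_add_le_right ht
  have hfinal := hT.comp hsub
  rw [ENNReal.toReal_mul, ENNReal.toReal_ofReal (by positivity), ← hK] at hfinal
  rw [integral_mul_const]
  convert hfinal.congr' ?_ using 2
  · ring
  filter_upwards [eventually_ge_atTop u] with t ht
  have hut : u + (t - u) = t := add_tsub_cancel_of_le ht
  simp only [Function.comp_apply, hut]
  rw [ENNReal.toReal_mul, ENNReal.toReal_ofReal (Real.exp_pos _).le, ← hw, ← mul_assoc,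
    ← Real.exp_add]
  congr 2
  rw [NNReal.coe_sub ht]
  ring

lemma integral_kennedyDensity_zero (hX : IsBrownianMotion P X x) :
    ∫ ω, kennedyDensity l ψ (runSup X 0 ω, X 0 ω) * Real.exp (-(l ^ 2 * (0 : ℝ≥0)) / 2) ∂P
      = kennedyDensity l ψ (x, x) := by
  have : ∀ᵐ ω ∂P, kennedyDensity l ψ (runSup X 0 ω, X 0 ω)
      * Real.exp (-(l ^ 2 * (0 : ℝ≥0)) / 2) = kennedyDensity l ψ (x, x) := by
    filter_upwards [hX.init] with ω h0
    simp [runSup_zero, h0]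
  rw [integral_congr_ae this]
  simp

end IsBrownianMotion

/-- Penalization by `ψ(S_t) e^{λ(S_t - X_t)}`: the ratio
`E_x[1_Γ ψ(S_t)e^{λ(S_t-X_t)}] / E_x[ψ(S_t)e^{λ(S_t-X_t)}]` converges, as `t → ∞`, to
`E_x[1_Γ M_u^{λ,φ}] / (1 - Φ(x))`, where `Φ(y) = 1 - e^{λy}∫_y^∞ ψ(z)e^{-λz}dz` and
`M^{λ,φ}` is the associated Kennedy martingale. -/
theorem penalization_kennedy
    {Ω : Type*} [m : MeasurableSpace Ω] (P : Measure Ω) [IsProbabilityMeasure P]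
    (lam : ℝ) (hlam : 0 < lam)
    (ψ : ℝ → ℝ) (hψmeas : Measurable ψ) (hψpos : ∀ z, 0 < ψ z)
    (hψint : ∀ x' : ℝ, IntegrableOn (fun z => ψ z * Real.exp (-(lam * z))) (Set.Ici x'))
    (x : ℝ) (X : ℝ≥0 → Ω → ℝ) (hX : IsBrownianMotion P X x)
    (Φ : ℝ → ℝ)
    (hΦ : ∀ y, Φ y = 1 - Real.exp (lam * y) * ∫ z in Set.Ici y, ψ z * Real.exp (-(lam * z)))
    (M : ℝ≥0 → Ω → ℝ)
    (hM : ∀ t ω, M t ω =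
      (ψ (runSup X t ω) * Real.sinh (lam * (runSup X t ω - X t ω)) / lam
          + Real.exp (lam * X t ω) *
            ∫ z in Set.Ici (runSup X t ω), ψ z * Real.exp (-(lam * z)))
        * Real.exp (-(lam ^ 2 * (t : ℝ)) / 2)) :
    ∀ (u : ℝ≥0) (Γ : Set Ω), MeasurableSet[natFiltration X u] Γ →
      Tendsto
        (fun t : ℝ≥0 =>
          (∫ ω in Γ, ψ (runSup X t ω) * Real.exp (lam * (runSup X t ω - X t ω)) ∂P)
            / ∫ ω, ψ (runSup X t ω) * Real.exp (lam * (runSup X t ω - X t ω)) ∂P)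
        atTop
        (nhds ((∫ ω in Γ, M u ω ∂P) / (1 - Φ x))) := by
  intro u Γ hΓ
  have hψ0 : ∀ z, 0 ≤ ψ z := fun z => (hψpos z).le
  have hMu : ∀ ω, M u ω = kennedyDensity lam ψ (runSup X u ω, X u ω)
      * Real.exp (-(lam ^ 2 * (u : ℝ)) / 2) := hM u
  have hΦx : 1 - Φ x = kennedyDensity lam ψ (x, x) := by
    rw [hΦ, kennedyDensity_diag, sub_sub_cancel]
  have hpos : 0 < 1 - Φ x := by
    rw [hΦx, kennedyDensity_diag]
    refine mul_pos (Real.exp_pos _) ?_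
    rw [setIntegral_pos_iff_support_of_nonneg_ae
      (.of_forall fun z => mul_nonneg (hψ0 z) (Real.exp_pos _).le) (hψint x)]
    have : Function.support (fun z => ψ z * Real.exp (-(lam * z))) = Set.univ :=
      Set.eq_univ_of_forall fun z => (mul_pos (hψpos z) (Real.exp_pos _)).ne'
    simp [this]
  have hnum := hX.tendsto_setIntegral_weight u hlam hψmeas hψ0 hψint hΓ
  have hden := hX.tendsto_setIntegral_weight 0 hlam hψmeas hψ0 hψint
    (Γ := Set.univ) MeasurableSet.univ
  simp only [setIntegral_univ] at hden
  rw [hX.integral_kennedyDensity_zero, ← hΦx] at hden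
  have h := hnum.div hden (mul_pos (mul_pos two_pos hlam) hpos).ne'
  rw [mul_div_mul_left _ _ (mul_pos two_pos hlam).ne'] at h
  simp_rw [hMu]
  refine h.congr fun t => ?_
  exact mul_div_mul_left _ _ (Real.exp_pos _).ne'

end
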